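/- For every dimension d ≥ 1 there are constants C and c (depending only on d) such that: for every nonempty finite set X ⊂ ℝ^d and every ε ∈ (0, 1/2) there exists a nonempty subset P ⊆ X with |P| ≤ C·(1/ε)·(log(1/ε))^{2d}·(log(2 + log(1/ε)))^c such that P is an ε-approximation of (X, R_d). -/

import Mathlib

open scoped Classical BigOperators

/-- The family `R_d` of axis-parallel boxes `∏ᵢ [aᵢ, bᵢ]` in `ℝ^d` with `aᵢ ≤ bᵢ`. -/
def Rfam (d : ℕ) : Set (Set (Fin d → ℝ)) :=
  {R | ∃ a b : Fin d → ℝ, a ≤ b ∧ R = Set.Icc a b}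

/-- `P` is an ε-approximation of `(X, A)`:  `P ⊆ X`, `P` nonempty, and for every range
`R ∈ A`, `| |R∩P|/|P| − |R∩X|/|X| | ≤ ε`. -/
def IsEpsApprox {α : Type*} (A : Set (Set α)) (ε : ℝ) (X P : Finset α) : Prop :=
  P ⊆ X ∧ P.Nonempty ∧ ∀ R ∈ A,
    |((P.filter (· ∈ R)).card : ℝ) / P.card -
      ((X.filter (· ∈ R)).card : ℝ) / X.card| ≤ ε

/-- Fewer linear constraints than variables: a nonzero vector supported on `F` on which all the
set sums of `𝒜` vanish. -/
lemma exists_ne_zero_forall_sum_eq_zero {α : Type*} (F : Finset α) (𝒜 : Finset (Finset α))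
    (h : 𝒜.card < F.card) :
    ∃ z : α → ℝ, (∀ v ∉ F, z v = 0) ∧ (∃ v ∈ F, z v ≠ 0) ∧ ∀ S ∈ 𝒜, ∑ v ∈ S, z v = 0 := by
  let ext0 : (F → ℝ) →ₗ[ℝ] (α → ℝ) :=
    { toFun := fun f v => if hv : v ∈ F then f ⟨v, hv⟩ else 0
      map_add' := by
        intro f g; ext v; by_cases hv : v ∈ F <;> simp [hv]
      map_smul' := by
        intro c f; ext v; by_cases hv : v ∈ F <;> simp [hv] }
  let L : (F → ℝ) →ₗ[ℝ] (𝒜 → ℝ) :=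
    LinearMap.pi fun S => (∑ v ∈ S.1, LinearMap.proj v) ∘ₗ ext0
  have hker : LinearMap.ker L ≠ ⊥ := by
    apply LinearMap.ker_ne_bot_of_finrank_lt
    simpa using h
  obtain ⟨f, hf, hf0⟩ := (Submodule.ne_bot_iff _).1 hker
  refine ⟨ext0 f, ?_, ?_, ?_⟩
  · intro v hv
    simp [ext0, hv]
  · obtain ⟨v, hv⟩ := Function.ne_iff.1 hf0
    exact ⟨v.1, v.2, by simpa [ext0] using hv⟩
  · intro S hS
    have := congrFun (LinearMap.mem_ker.1 hf) ⟨S, hS⟩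
    simpa [L] using this

/-- Moving from a point of the cube along a nonzero direction until the boundary is hit. -/
lemma exists_abs_add_mul_eq_one {α : Type*} (F : Finset α) (x z : α → ℝ)
    (hx : ∀ v ∈ F, |x v| ≤ 1) (hz : ∃ v ∈ F, z v ≠ 0) :
    ∃ s : ℝ, (∀ v ∈ F, |x v + s * z v| ≤ 1) ∧ ∃ v ∈ F, |x v + s * z v| = 1 := by
  let τ : α → ℝ := fun v => if 0 < z v then (1 - x v) / z v else (-1 - x v) / z v
  obtain ⟨w, hw, hmin⟩ := (F.filter fun v => z v ≠ 0).exists_min_image τ (by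
    obtain ⟨v, hv, hv0⟩ := hz
    exact ⟨v, by simp [hv, hv0]⟩)
  have hτ : ∀ v ∈ F, z v ≠ 0 → 0 ≤ τ v := by
    intro v hv hv0
    have h1 := abs_le.1 (hx v hv)
    simp only [τ]
    split_ifs with h
    · exact div_nonneg (by linarith) h.le
    · exact div_nonneg_of_nonpos (by linarith) (not_lt.1 h)
  rw [Finset.mem_filter] at hw
  refine ⟨τ w, ?_, w, hw.1, ?_⟩
  · intro v hv
    by_cases hv0 : z v = 0
    · simpa [hv0] using hx v hv
    have h1 := abs_le.1 (hx v hv)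
    have h2 := hmin v (by simp [hv, hv0])
    have h3 := hτ w hw.1 hw.2
    rcases lt_or_gt_of_ne hv0 with hneg | hpos
    · have h4 : τ v * z v = -1 - x v := by
        simp only [τ, if_neg (not_lt.2 hneg.le)]
        field_simp
      rw [abs_le]
      constructor <;> nlinarith
    · have h4 : τ v * z v = 1 - x v := by
        simp only [τ, if_pos hpos]
        field_simp
      rw [abs_le]
      constructor <;> nlinarith
  · have hw0 := hw.2
    by_cases h : 0 < z w
    · have : τ w * z w = 1 - x w := by
        simp only [τ, if_pos h]
        field_simp
      rw [this]; simp
    · have : τ w * z w = -1 - x w := by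
        simp only [τ, if_neg h]
        field_simp
      rw [this]; simp

/-- The Beck–Fiala theorem in its rounding form: if every element of `F` lies in at most `t` sets
of `𝓕`, the values of `x` on `F` can be rounded to `±1` changing every set sum by at most `2t`. -/
theorem beck_fiala {α : Type*} (𝓕 : Finset (Finset α)) (t : ℕ) (F : Finset α)
    (hdeg : ∀ v ∈ F, (𝓕.filter (v ∈ ·)).card ≤ t) (x : α → ℝ) (hx : ∀ v ∈ F, |x v| ≤ 1) :
    ∃ y : α → ℝ, (∀ v ∉ F, y v = x v) ∧ (∀ v ∈ F, |y v| = 1) ∧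
      ∀ S ∈ 𝓕, |∑ v ∈ S, y v - ∑ v ∈ S, x v| ≤ 2 * t := by
  induction F using Finset.strongInduction generalizing x with
  | H F ih =>
  rcases F.eq_empty_or_nonempty with rfl | hF
  · exact ⟨x, by simp, by simp, by simp⟩
  let 𝒜 := 𝓕.filter fun S => t < (S ∩ F).card
  have hcard : 𝒜.card < F.card := by
    have h1 : 𝒜.card * (t + 1) ≤ ∑ S ∈ 𝒜, (S ∩ F).card := by
      rw [← smul_eq_mul]
      exact Finset.card_nsmul_le_sum _ _ _ fun S hS => (Finset.mem_filter.1 hS).2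
    have h2 : ∑ S ∈ 𝒜, (S ∩ F).card = ∑ v ∈ F, (𝒜.filter (v ∈ ·)).card := by
      have := Finset.sum_card_bipartiteAbove_eq_sum_card_bipartiteBelow
        (s := F) (t := 𝒜) (fun v S => v ∈ S)
      simp only [Finset.bipartiteAbove, Finset.bipartiteBelow] at this
      rw [this]
      refine Finset.sum_congr rfl fun S _ => ?_
      congr 1
      ext v
      simp [and_comm]
    have h3 : ∑ v ∈ F, (𝒜.filter (v ∈ ·)).card ≤ F.card * t := by
      rw [← smul_eq_mul]
      refine Finset.sum_le_card_nsmul _ _ _ fun v hv => le_trans ?_ (hdeg v hv)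
      exact Finset.card_le_card (Finset.filter_subset_filter _ (Finset.filter_subset _ _))
    have h4 := hF.card_pos
    nlinarith
  obtain ⟨z, hz0, hz1, hz2⟩ := exists_ne_zero_forall_sum_eq_zero F 𝒜 hcard
  obtain ⟨s, hs, w, hw, hsw⟩ := exists_abs_add_mul_eq_one F x z hx hz1
  obtain ⟨y, hy0, hy1, hy2⟩ := ih (F.erase w) (Finset.erase_ssubset hw)
    (fun v hv => hdeg v (Finset.mem_of_mem_erase hv)) (fun v => x v + s * z v)
    (fun v hv => hs v (Finset.mem_of_mem_erase hv))
  have hyF : ∀ v ∈ F, |y v| = 1 := by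
    intro v hv
    by_cases hvw : v = w
    · rw [hvw, hy0 w (by simp)]
      exact hsw
    · exact hy1 v (by simp [hvw, hv])
  have hyx : ∀ v ∉ F, y v = x v := by
    intro v hv
    rw [hy0 v (fun h => hv (Finset.mem_of_mem_erase h)), hz0 v hv]
    simp
  refine ⟨y, hyx, hyF, fun S hS => ?_⟩
  by_cases hA : t < (S ∩ F).card
  · have h1 := hz2 S (Finset.mem_filter.2 ⟨hS, hA⟩)
    have h2 := hy2 S hS
    rwa [Finset.sum_add_distrib, ← Finset.mul_sum, h1, mul_zero, add_zero] at h2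
  · have h1 : ∑ v ∈ S, y v - ∑ v ∈ S, x v = ∑ v ∈ S ∩ F, (y v - x v) := by
      rw [← Finset.sum_sub_distrib]
      refine (Finset.sum_subset Finset.inter_subset_left fun v hv hv' => ?_).symm
      rw [hyx v fun h => hv' (Finset.mem_inter.2 ⟨hv, h⟩), sub_self]
    rw [h1]
    calc |∑ v ∈ S ∩ F, (y v - x v)| ≤ ∑ v ∈ S ∩ F, |y v - x v| := Finset.abs_sum_le_sum_abs _ _
      _ ≤ ∑ v ∈ S ∩ F, (2 : ℝ) := by
          refine Finset.sum_le_sum fun v hv => ?_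
          have hv := (Finset.mem_inter.1 hv).2
          calc |y v - x v| ≤ |y v| + |x v| := abs_sub _ _
            _ ≤ 2 := by linarith [hyF v hv, hx v hv]
      _ = 2 * ((S ∩ F).card : ℝ) := by simp [mul_comm]
      _ ≤ 2 * t := by
          have : ((S ∩ F).card : ℝ) ≤ t := by exact_mod_cast not_lt.1 hA
          linarith

/-- The initial segment `[0, u)` as a sum of dyadic intervals, one for each binary digit of `u`. -/
lemma ite_lt_eq_sum_dyadic (k u r : ℕ) (hu : u < 2 ^ k) :
    (if r < u then (1 : ℝ) else 0) =
      ∑ j : Fin k, (if u / 2 ^ (j : ℕ) % 2 = 1 then (1 : ℝ) else 0) *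
        (if r / 2 ^ (j : ℕ) + 1 = u / 2 ^ (j : ℕ) then 1 else 0) := by
  induction k generalizing u r with
  | zero => simp at hu; simp [hu]
  | succ k ih =>
    have h := ih (u / 2) (r / 2) (by rw [pow_succ] at hu; omega)
    rw [Fin.sum_univ_succ]
    have h2 : ∀ n j : ℕ, n / 2 ^ (j + 1) = n / 2 / 2 ^ j := fun n j => by
      rw [pow_succ', Nat.div_div_eq_div_mul]
    simp only [Fin.val_succ, h2, ← h, Fin.val_zero, pow_zero, Nat.div_one]
    by_cases h3 : u % 2 = 1 <;> by_cases h4 : r + 1 = u <;> by_cases h5 : r / 2 < u / 2 <;>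
      by_cases h6 : r < u <;> simp only [h3, h4, h5, h6, if_true, if_false] <;>
      first
        | (exfalso; omega)
        | norm_num

/-- An integer interval as a signed combination of dyadic intervals. -/
lemma exists_sum_dyadic_eq_ite (k l u : ℕ) (hlu : l ≤ u) (hu : u < 2 ^ k) :
    ∃ (c : Fin k × Bool → ℝ) (q : Fin k × Bool → ℕ), (∀ s, |c s| ≤ 1) ∧
      ∀ r : ℕ, (if l ≤ r ∧ r < u then (1 : ℝ) else 0) =
        ∑ s, c s * (if r / 2 ^ (s.1 : ℕ) + 1 = q s then 1 else 0) := by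
  refine ⟨fun s => if s.2 then (if u / 2 ^ (s.1 : ℕ) % 2 = 1 then 1 else 0)
    else -(if l / 2 ^ (s.1 : ℕ) % 2 = 1 then 1 else 0),
    fun s => if s.2 then u / 2 ^ (s.1 : ℕ) else l / 2 ^ (s.1 : ℕ), ?_, ?_⟩
  · rintro ⟨j, b⟩
    cases b <;> simp only [Bool.false_eq_true, if_true, if_false] <;> split_ifs <;> simp
  · intro r
    have h1 : (if l ≤ r ∧ r < u then (1 : ℝ) else 0) =
        (if r < u then 1 else 0) - (if r < l then 1 else 0) := by
      by_cases h1 : r < u <;> by_cases h2 : r < l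
      · simp [h1, h2]
      · simp [h1, h2, not_lt.1 h2]
      · omega
      · simp [h1, h2]
    rw [h1, ite_lt_eq_sum_dyadic k u r hu, ite_lt_eq_sum_dyadic k l r (hlu.trans_lt hu),
      Fintype.sum_prod_type, ← Finset.sum_sub_distrib]
    refine Finset.sum_congr rfl fun j _ => ?_
    simp only [Fintype.sum_bool, if_true, Bool.false_eq_true, if_false]
    ring

/-- Signings with small discrepancy on all integer boxes, for points with bounded coordinates. -/
lemma exists_signing_nat_boxes {α : Type*} (d k : ℕ) (X : Finset α) (ρ : α → Fin d → ℕ) :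
    ∃ χ : α → ℝ, (∀ v ∈ X, |χ v| = 1) ∧
      ∀ l u : Fin d → ℕ, l ≤ u → (∀ i, u i < 2 ^ k) →
        |∑ v ∈ X.filter (fun v => ∀ i, l i ≤ ρ v i ∧ ρ v i < u i), χ v| ≤
          (2 * k) ^ d * (2 * k ^ d) := by
  let cell : (Fin d → Fin k) → α → Finset α := fun j v =>
    X.filter fun w => ∀ i, ρ w i / 2 ^ (j i : ℕ) = ρ v i / 2 ^ (j i : ℕ)
  let 𝓕 : Finset (Finset α) :=
    (Finset.univ ×ˢ X).image fun p : (Fin d → Fin k) × α => cell p.1 p.2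
  have hdeg : ∀ v ∈ X, (𝓕.filter (v ∈ ·)).card ≤ k ^ d := by
    intro v hv
    have hsub : 𝓕.filter (v ∈ ·) ⊆ Finset.univ.image fun j => cell j v := by
      intro S hS
      simp only [Finset.mem_filter, 𝓕, Finset.mem_image, Finset.mem_product] at hS
      obtain ⟨⟨⟨j, w⟩, -, rfl⟩, hvS⟩ := hS
      refine Finset.mem_image.2 ⟨j, Finset.mem_univ _, ?_⟩
      simp only [cell, Finset.mem_filter] at hvS ⊢
      simp only [hvS.2]
    calc (𝓕.filter (v ∈ ·)).card ≤ (Finset.univ.image fun j => cell j v).card :=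
          Finset.card_le_card hsub
      _ ≤ (Finset.univ : Finset (Fin d → Fin k)).card := Finset.card_image_le
      _ = k ^ d := by simp
  obtain ⟨χ, -, h1, h2⟩ := beck_fiala 𝓕 (k ^ d) X hdeg (fun _ => 0) (by simp)
  refine ⟨χ, h1, fun l u hlu hu => ?_⟩
  have hcell : ∀ (j : Fin d → Fin k) (q : Fin d → ℕ),
      |∑ v ∈ X, χ v * (if ∀ i, ρ v i / 2 ^ (j i : ℕ) + 1 = q i then 1 else 0)| ≤
        2 * (k : ℝ) ^ d := by
    intro j q
    simp only [mul_ite, mul_one, mul_zero, ← Finset.sum_filter]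
    by_cases h : ∃ v ∈ X, ∀ i, ρ v i / 2 ^ (j i : ℕ) + 1 = q i
    · obtain ⟨v, hv, hvq⟩ := h
      have h3 := h2 (cell j v) (Finset.mem_image.2 ⟨(j, v), by simp [hv], rfl⟩)
      simp only [Finset.sum_const_zero, sub_zero, cell, Nat.cast_pow] at h3
      simpa only [← hvq, Nat.add_right_cancel_iff] using h3
    · rw [Finset.filter_false_of_mem fun v hv hq => h ⟨v, hv, hq⟩]
      simp
  choose c q hc hcq using fun i => exists_sum_dyadic_eq_ite k (l i) (u i) (hlu i) (hu i)
  have hind : ∀ v, (if ∀ i, l i ≤ ρ v i ∧ ρ v i < u i then (1 : ℝ) else 0) =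
      ∑ s : Fin d → Fin k × Bool, (∏ i, c i (s i)) *
        (if ∀ i, ρ v i / 2 ^ ((s i).1 : ℕ) + 1 = q i (s i) then 1 else 0) := by
    intro v
    have hprod : ∀ (p : Fin d → Prop) [DecidablePred p] [Decidable (∀ i, p i)],
        (if ∀ i, p i then (1 : ℝ) else 0) = ∏ i, if p i then (1 : ℝ) else 0 := by
      intro p _ _
      rw [Finset.prod_ite_zero]
      simp
    rw [hprod]
    simp only [hcq]
    rw [Finset.prod_univ_sum, Fintype.piFinset_univ]
    refine Finset.sum_congr rfl fun s _ => ?_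
    rw [Finset.prod_mul_distrib, ← hprod]
  have hsum : ∑ v ∈ X.filter (fun v => ∀ i, l i ≤ ρ v i ∧ ρ v i < u i), χ v =
      ∑ s : Fin d → Fin k × Bool, (∏ i, c i (s i)) *
        ∑ v ∈ X, χ v *
          (if ∀ i, ρ v i / 2 ^ ((s i).1 : ℕ) + 1 = q i (s i) then 1 else 0) := by
    have h3 : ∑ v ∈ X.filter (fun v => ∀ i, l i ≤ ρ v i ∧ ρ v i < u i), χ v =
        ∑ v ∈ X, χ v * (if ∀ i, l i ≤ ρ v i ∧ ρ v i < u i then (1 : ℝ) else 0) := by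
      simp only [mul_ite, mul_one, mul_zero, ← Finset.sum_filter]
    rw [h3]
    simp only [hind, Finset.mul_sum]
    rw [Finset.sum_comm]
    refine Finset.sum_congr rfl fun s _ => Finset.sum_congr rfl fun v _ => ?_
    ring
  rw [hsum]
  calc _ ≤ ∑ s : Fin d → Fin k × Bool, |(∏ i, c i (s i)) *
        ∑ v ∈ X, χ v *
          (if ∀ i, ρ v i / 2 ^ ((s i).1 : ℕ) + 1 = q i (s i) then 1 else 0)| :=
        Finset.abs_sum_le_sum_abs _ _
    _ ≤ ∑ s : Fin d → Fin k × Bool, (2 * (k : ℝ) ^ d) := by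
        refine Finset.sum_le_sum fun s _ => ?_
        rw [abs_mul, Finset.abs_prod]
        calc _ ≤ 1 * (2 * (k : ℝ) ^ d) := by
              refine mul_le_mul ?_ (hcell _ _) (abs_nonneg _) zero_le_one
              exact Finset.prod_le_one (fun _ _ => abs_nonneg _) fun i _ => hc i _
          _ = _ := one_mul _
    _ = (2 * k) ^ d * (2 * k ^ d) := by
        simp [mul_comm]

/-- Signings of a finite point set with small discrepancy on all axis-parallel boxes. -/
lemma exists_signing_boxes (d k : ℕ) (X : Finset (Fin d → ℝ)) (hX : X.card < 2 ^ k) :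
    ∃ χ : (Fin d → ℝ) → ℝ, (∀ v ∈ X, |χ v| = 1) ∧
      ∀ R ∈ Rfam d, |∑ v ∈ X.filter (· ∈ R), χ v| ≤ (2 * k) ^ d * (2 * k ^ d) := by
  obtain ⟨χ, h1, h2⟩ := exists_signing_nat_boxes d k X
    fun v i => (X.filter fun w => w i < v i).card
  refine ⟨χ, h1, ?_⟩
  rintro _ ⟨a, b, hab, rfl⟩
  have h3 := h2 (fun i => (X.filter fun w => w i < a i).card)
    (fun i => (X.filter fun w => w i ≤ b i).card)
    (fun i => Finset.card_le_card fun w hw => by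
      simp only [Finset.mem_filter] at hw ⊢
      exact ⟨hw.1, hw.2.le.trans (hab i)⟩)
    (fun i => (Finset.card_filter_le _ _).trans_lt hX)
  convert h3 using 3
  ext v
  simp only [Finset.mem_filter]
  refine and_congr_right fun hv => ?_
  rw [Set.mem_Icc, Pi.le_def, Pi.le_def, ← forall_and]
  refine forall_congr' fun i => and_congr ⟨fun h => ?_, fun h => ?_⟩ ⟨fun h => ?_, fun h => ?_⟩
  · refine Finset.card_le_card fun w hw => ?_
    simp only [Finset.mem_filter] at hw ⊢
    exact ⟨hw.1, hw.2.trans_le h⟩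
  · by_contra! hlt
    refine absurd h (not_le.2 (Finset.card_lt_card ?_))
    refine Finset.ssubset_iff_of_subset (fun w hw => ?_) |>.2 ⟨v, ?_, ?_⟩
    · simp only [Finset.mem_filter] at hw ⊢
      exact ⟨hw.1, hw.2.trans hlt⟩
    · simp [hv, hlt]
    · simp
  · refine Finset.card_lt_card ?_
    refine Finset.ssubset_iff_of_subset (fun w hw => ?_) |>.2 ⟨v, ?_, ?_⟩
    · simp only [Finset.mem_filter] at hw ⊢
      exact ⟨hw.1, hw.2.le.trans h⟩
    · simp [hv, h]
    · simp
  · by_contra! hlt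
    refine absurd h (not_lt.2 (Finset.card_le_card fun w hw => ?_))
    simp only [Finset.mem_filter] at hw ⊢
    exact ⟨hw.1, hw.2.trans_lt hlt⟩

/-- The discrepancy bound for boxes and fewer than `2 ^ k` points. -/
noncomputable def boxDisc (d k : ℕ) : ℝ := (2 * k) ^ d * (2 * k ^ d)

lemma exists_mem_Rfam_forall_mem {d : ℕ} (X : Finset (Fin d → ℝ)) :
    ∃ R ∈ Rfam d, ∀ v ∈ X, v ∈ R := by
  rcases X.eq_empty_or_nonempty with rfl | ⟨v, hv⟩
  · exact ⟨Set.Icc 0 0, ⟨0, 0, le_rfl, rfl⟩, by simp⟩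
  obtain ⟨a, ha⟩ := X.finite_toSet.bddBelow
  obtain ⟨b, hb⟩ := X.finite_toSet.bddAbove
  exact ⟨Set.Icc a b, ⟨a, b, (ha hv).trans (hb hv), rfl⟩, fun v hv => ⟨ha hv, hb hv⟩⟩

/-- One halving step: a subset of about half the size that halves every box count up to the
discrepancy. -/
lemma exists_half (d k : ℕ) (X : Finset (Fin d → ℝ)) (hX : X.card < 2 ^ k)
    (hD : 2 * boxDisc d k ≤ X.card) :
    ∃ P ⊆ X, 2 * P.card ≤ X.card ∧ (X.card : ℝ) ≤ 4 * P.card ∧ ∀ R ∈ Rfam d,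
      |2 * ((P.filter (· ∈ R)).card : ℝ) - (X.filter (· ∈ R)).card| ≤ boxDisc d k := by
  have hsigned : ∃ χ : (Fin d → ℝ) → ℝ, (∀ v ∈ X, |χ v| = 1) ∧
      (∀ R ∈ Rfam d, |∑ v ∈ X.filter (· ∈ R), χ v| ≤ boxDisc d k) ∧ ∑ v ∈ X, χ v ≤ 0 := by
    obtain ⟨χ, h1, h2⟩ := exists_signing_boxes d k X hX
    rcases le_total (∑ v ∈ X, χ v) 0 with h | h
    · exact ⟨χ, h1, h2, h⟩
    · refine ⟨fun v => -χ v, by simpa using h1, fun R hR => ?_, by simpa using h⟩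
      rw [Finset.sum_neg_distrib, abs_neg]
      exact h2 R hR
  obtain ⟨χ, h1, h2, h3⟩ := hsigned
  have key : ∀ p : (Fin d → ℝ) → Prop,
      2 * (((X.filter fun v => χ v = 1).filter p).card : ℝ) - (X.filter p).card =
        ∑ v ∈ X.filter p, χ v := by
    intro p
    rw [Finset.filter_comm, Finset.card_filter _ (X.filter p), Finset.card_eq_sum_ones]
    push_cast
    rw [Finset.mul_sum, ← Finset.sum_sub_distrib]
    refine Finset.sum_congr rfl fun v hv => ?_
    rcases (abs_eq zero_le_one).1 (h1 v (Finset.mem_of_mem_filter v hv)) with h | h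
    · rw [h]; norm_num
    · rw [h]; norm_num
  obtain ⟨R₀, hR₀, hXR₀⟩ := exists_mem_Rfam_forall_mem X
  have hall := key fun _ => True
  simp only [Finset.filter_true] at hall
  have hdisc := h2 R₀ hR₀
  rw [Finset.filter_true_of_mem hXR₀, ← hall, abs_le] at hdisc
  refine ⟨X.filter fun v => χ v = 1, Finset.filter_subset _ _, ?_, by linarith, fun R hR => ?_⟩
  · have : 2 * ((X.filter fun v => χ v = 1).card : ℝ) ≤ X.card := by linarith
    exact_mod_cast this
  · rw [key]
    exact h2 R hR

/-- Halving a set with discrepancy `D` changes relative frequencies by at most `4D/n`. -/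
lemma abs_div_sub_div_le {n n' r r' D : ℝ} (hn : 0 < n) (hr : 0 ≤ r) (hrn : r ≤ n)
    (hn' : n ≤ 4 * n') (h : |2 * r' - r| ≤ D) (hD : |2 * n' - n| ≤ D) :
    |r' / n' - r / n| ≤ 4 * D / n := by
  have hpos : 0 < n' := by linarith
  have h0 : 0 ≤ D := (abs_nonneg _).trans h
  have h1 : r' / n' - r / n = (2 * r' - r) / (2 * n') - r / n * ((2 * n' - n) / (2 * n')) := by
    field_simp
    ring
  have h2 : |r / n| ≤ 1 := by
    rw [abs_of_nonneg (by positivity)]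
    exact div_le_one_of_le₀ hrn hn.le
  have h3 : ∀ w : ℝ, |w| ≤ D → |w / (2 * n')| ≤ D / (2 * n') := by
    intro w hw
    rw [abs_div, abs_of_pos (by positivity : 0 < 2 * n')]
    gcongr
  rw [h1]
  calc _ ≤ |(2 * r' - r) / (2 * n')| + |r / n * ((2 * n' - n) / (2 * n'))| := abs_sub _ _
    _ ≤ D / (2 * n') + 1 * (D / (2 * n')) := by
        rw [abs_mul]
        exact add_le_add (h3 _ h) (mul_le_mul h2 (h3 _ hD) (abs_nonneg _) zero_le_one)
    _ = D / n' := by field_simp; ring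
    _ ≤ D / (n / 4) := by
        apply div_le_div_of_nonneg_left h0 (by positivity)
        linarith
    _ = 4 * D / n := by field_simp

/-- Repeated halving down to at most `2 ^ m` points. -/
lemma exists_approx_card_le (d m : ℕ)
    (hm : ∀ t : ℕ, 8 * boxDisc d (m + t + 2) ≤ 2 ^ (m + t + 1)) (i : ℕ)
    (X : Finset (Fin d → ℝ)) (hX : X.Nonempty) (hcard : X.card ≤ 2 ^ (m + i)) :
    ∃ P : Finset (Fin d → ℝ), P.card ≤ 2 ^ m ∧
      IsEpsApprox (Rfam d)
        (∑ t ∈ Finset.range i, 8 * boxDisc d (m + t + 2) / 2 ^ (m + t + 1)) X P := by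
  induction i generalizing X with
  | zero => exact ⟨X, hcard, Finset.Subset.refl _, hX, by simp⟩
  | succ i ih =>
    have hnonneg : 0 ≤ boxDisc d (m + i + 2) := by unfold boxDisc; positivity
    rw [Finset.sum_range_succ]
    by_cases hsmall : X.card ≤ 2 ^ (m + i)
    · obtain ⟨P, hP, hPX, hP0, happ⟩ := ih X hX hsmall
      refine ⟨P, hP, hPX, hP0, fun R hR => (happ R hR).trans ?_⟩
      have : 0 ≤ 8 * boxDisc d (m + i + 2) / 2 ^ (m + i + 1) := by positivity
      linarith
    have hlarge : (2 : ℝ) ^ (m + i) < X.card := by exact_mod_cast not_le.1 hsmall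
    have hpow : (2 : ℝ) ^ (m + i + 1) = 2 * 2 ^ (m + i) := pow_succ' _ _
    have hlt : X.card < 2 ^ (m + i + 2) :=
      hcard.trans_lt (Nat.pow_lt_pow_right (by norm_num) (by omega))
    obtain ⟨Q, hQX, hQ2, hQ4, hQ⟩ := exists_half d (m + i + 2) X hlt (by linarith [hm i])
    have hXpos : (0 : ℝ) < X.card := by exact_mod_cast hX.card_pos
    have hQ0 : Q.Nonempty := by
      rw [← Finset.card_pos]
      have : (0 : ℝ) < Q.card := by linarith
      exact_mod_cast this
    obtain ⟨P, hP, hPQ, hP0, happ⟩ := ih Q hQ0 (by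
      rw [← add_assoc, pow_succ] at hcard
      omega)
    refine ⟨P, hP, hPQ.trans hQX, hP0, fun R hR => ?_⟩
    obtain ⟨R₀, hR₀, hXR₀⟩ := exists_mem_Rfam_forall_mem X
    have hfull := hQ R₀ hR₀
    rw [Finset.filter_true_of_mem fun v hv => hXR₀ v (hQX hv),
      Finset.filter_true_of_mem hXR₀] at hfull
    have hstep := abs_div_sub_div_le hXpos (Nat.cast_nonneg (X.filter (· ∈ R)).card)
      (by exact_mod_cast Finset.card_filter_le _ _) hQ4 (hQ R hR) hfull
    have hle : 4 * boxDisc d (m + i + 2) / X.card ≤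
        8 * boxDisc d (m + i + 2) / 2 ^ (m + i + 1) := by
      rw [hpow, div_le_div_iff₀ hXpos (by positivity)]
      nlinarith
    exact (abs_sub_le _ _ _).trans (add_le_add (happ R hR) (hstep.trans hle))

/-- The accumulated error of repeated halving is dominated by its last step. -/
lemma exists_sum_boxDisc_le (d : ℕ) :
    ∃ K : ℝ, 1 ≤ K ∧ ∀ m N : ℕ,
      ∑ t ∈ Finset.range N, 8 * boxDisc d (m + t + 2) / 2 ^ (m + t + 1) ≤
        K * (m + 2) ^ (2 * d) / 2 ^ m := by
  have hsum : Summable fun t : ℕ => ((t + 1 : ℕ) : ℝ) ^ (2 * d) * (1 / 2) ^ (t + 1) :=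
    (summable_nat_add_iff 1).2
      (summable_pow_mul_geometric_of_norm_lt_one (2 * d) (r := (1 / 2 : ℝ)) (by norm_num))
  set S := ∑' t : ℕ, ((t + 1 : ℕ) : ℝ) ^ (2 * d) * (1 / 2) ^ (t + 1)
  have hS0 : 0 ≤ S := tsum_nonneg fun t => by positivity
  refine ⟨16 * 2 ^ d * S + 1, by nlinarith [pow_pos (two_pos : (0 : ℝ) < 2) d], fun m N => ?_⟩
  have hterm : ∀ t : ℕ, 8 * boxDisc d (m + t + 2) / 2 ^ (m + t + 1) ≤
      16 * 2 ^ d * ((m + 2) ^ (2 * d) / 2 ^ m) *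
        (((t + 1 : ℕ) : ℝ) ^ (2 * d) * (1 / 2) ^ (t + 1)) := by
    intro t
    have h1 : boxDisc d (m + t + 2) = 2 * 2 ^ d * ((m : ℝ) + t + 2) ^ (2 * d) := by
      unfold boxDisc
      push_cast
      rw [mul_pow, two_mul d, pow_add]
      ring
    have h2 : ((m : ℝ) + t + 2) ^ (2 * d) ≤ (m + 2) ^ (2 * d) * (t + 1) ^ (2 * d) := by
      rw [← mul_pow]
      gcongr
      nlinarith [mul_nonneg (Nat.cast_nonneg m : (0 : ℝ) ≤ m) (Nat.cast_nonneg t : (0 : ℝ) ≤ t),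
        (Nat.cast_nonneg t : (0 : ℝ) ≤ t)]
    rw [h1, add_assoc m t 1, pow_add, one_div, inv_pow]
    push_cast
    calc _ ≤ 8 * (2 * 2 ^ d * ((m + 2) ^ (2 * d) * (t + 1) ^ (2 * d))) /
          ((2 : ℝ) ^ m * 2 ^ (t + 1)) := by gcongr
      _ = _ := by field_simp; ring
  calc _ ≤ ∑ t ∈ Finset.range N, 16 * 2 ^ d * ((m + 2) ^ (2 * d) / 2 ^ m) *
        (((t + 1 : ℕ) : ℝ) ^ (2 * d) * (1 / 2) ^ (t + 1)) :=
        Finset.sum_le_sum fun t _ => hterm t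
    _ ≤ 16 * 2 ^ d * ((m + 2) ^ (2 * d) / 2 ^ m) * S := by
        rw [← Finset.mul_sum]
        gcongr
        exact hsum.sum_le_tsum _ fun t _ => by positivity
    _ = 16 * 2 ^ d * S * (m + 2) ^ (2 * d) / 2 ^ m := by ring
    _ ≤ _ := by
        gcongr
        linarith

/-- A power of two balancing `K (m + 2) ^ e / 2 ^ m` against `ε`. -/
lemma exists_two_pow_le (K : ℝ) (hK : 1 ≤ K) (e : ℕ) :
    ∃ A : ℝ, ∀ ε : ℝ, 0 < ε → ε < 1 / 2 → ∃ m : ℕ,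
      K * (m + 2) ^ e / 2 ^ m ≤ ε ∧ (2 : ℝ) ^ m ≤ A * (1 / ε) * Real.log (1 / ε) ^ e := by
  have htend : ∀ r : ℝ, 0 < r → r < 1 →
      Filter.Tendsto (fun m : ℕ => ((m : ℝ) + 2) ^ e * r ^ m) Filter.atTop (nhds 0) := by
    intro r hr0 hr1
    have h := ((tendsto_pow_const_mul_const_pow_of_abs_lt_one e
      (by rwa [abs_of_pos hr0] : |r| < 1)).comp (Filter.tendsto_add_atTop_nat 2)).const_mul
      ((r ^ 2)⁻¹)
    rw [mul_zero] at h
    refine h.congr fun m => ?_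
    simp only [Function.comp, Nat.cast_add, Nat.cast_ofNat, pow_add]
    field_simp
  obtain ⟨B₀, hB₀⟩ := (htend (2 / 3) (by norm_num) (by norm_num)).bddAbove_range
  set B := max B₀ 1
  have hB : ∀ p : ℕ, ((p : ℝ) + 2) ^ e ≤ B * (3 / 2) ^ p := by
    intro p
    have h : ((p : ℝ) + 2) ^ e * (2 / 3) ^ p ≤ B := (hB₀ ⟨p, rfl⟩).trans (le_max_left _ _)
    calc ((p : ℝ) + 2) ^ e = ((p : ℝ) + 2) ^ e * (2 / 3) ^ p * (3 / 2) ^ p := by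
          rw [mul_assoc, ← mul_pow]; norm_num
      _ ≤ B * (3 / 2) ^ p := by gcongr
  have hB1 : 1 ≤ B := le_max_right _ _
  have hl2 : 0 < Real.log 2 := Real.log_pos (by norm_num)
  have hl43 : 0 < Real.log (4 / 3) := Real.log_pos (by norm_num)
  have hlKB : 0 ≤ Real.log (K * B) := Real.log_nonneg (by nlinarith)
  set A := (Real.log (K * B) / Real.log 2 + 1) / Real.log (4 / 3) + 2 / Real.log 2
  refine ⟨2 * K * A ^ e, fun ε hε hε2 => ?_⟩
  have hex : ∃ m : ℕ, K * (m + 2) ^ e / 2 ^ m ≤ ε := by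
    have h := (htend (1 / 2) (by norm_num) (by norm_num)).const_mul K
    rw [mul_zero] at h
    obtain ⟨m, hm⟩ := (h.eventually_le_const hε).exists
    refine ⟨m, le_trans (le_of_eq ?_) hm⟩
    rw [one_div, inv_pow]
    ring
  refine ⟨Nat.find hex, Nat.find_spec hex, ?_⟩
  have hne : Nat.find hex ≠ 0 := by
    intro h0
    have h := Nat.find_spec hex
    rw [h0] at h
    have h1 : (1 : ℝ) ≤ ((0 : ℕ) + 2) ^ e := one_le_pow₀ (by norm_num)
    rw [pow_zero, div_one] at h
    nlinarith
  obtain ⟨p, hp⟩ := Nat.exists_eq_succ_of_ne_zero hne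
  have hmin := not_le.1 (Nat.find_min hex (show p < Nat.find hex by omega))
  rw [lt_div_iff₀ (by positivity)] at hmin
  have hinv : 2 ≤ 1 / ε := by
    rw [le_div_iff₀ hε]; linarith
  have hlog : Real.log 2 ≤ Real.log (1 / ε) := Real.log_le_log (by norm_num) hinv
  have hp1 : (4 / 3 : ℝ) ^ p ≤ K * B * (1 / ε) := by
    have h1 : ε * (2 : ℝ) ^ p ≤ K * (B * (3 / 2) ^ p) :=
      hmin.le.trans (mul_le_mul_of_nonneg_left (hB p) (by linarith))
    have h2 : (2 : ℝ) ^ p = (4 / 3) ^ p * (3 / 2) ^ p := by rw [← mul_pow]; norm_num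
    rw [h2] at h1
    have h3 : (0 : ℝ) < (3 / 2) ^ p := by positivity
    rw [mul_one_div, le_div_iff₀ hε]
    nlinarith
  have hp2 : (p : ℝ) * Real.log (4 / 3) ≤ Real.log (K * B) + Real.log (1 / ε) := by
    rw [← Real.log_pow, ← Real.log_mul (by positivity) (by positivity)]
    exact Real.log_le_log (by positivity) hp1
  have hp3 : (p : ℝ) + 2 ≤ A * Real.log (1 / ε) := by
    have h1 : Real.log (K * B) ≤ Real.log (K * B) / Real.log 2 * Real.log (1 / ε) := by
      rw [div_mul_eq_mul_div, le_div_iff₀ hl2]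
      gcongr
    have h2 : 2 ≤ 2 / Real.log 2 * Real.log (1 / ε) := by
      rw [div_mul_eq_mul_div, le_div_iff₀ hl2]
      gcongr
    have h3 : (p : ℝ) ≤
        (Real.log (K * B) / Real.log 2 + 1) / Real.log (4 / 3) * Real.log (1 / ε) := by
      rw [div_mul_eq_mul_div, le_div_iff₀ hl43]
      linarith
    simp only [A, add_mul] at *
    linarith
  rw [hp, pow_succ]
  calc (2 : ℝ) ^ p * 2 = 2 * (1 / ε) * (ε * 2 ^ p) := by field_simp
    _ ≤ 2 * (1 / ε) * (K * (A * Real.log (1 / ε)) ^ e) := by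
        refine mul_le_mul_of_nonneg_left (hmin.le.trans ?_) (by positivity)
        gcongr
    _ = 2 * K * A ^ e * (1 / ε) * Real.log (1 / ε) ^ e := by
        rw [mul_pow]; ring

/-- small ε-approximations for `(X, R_d)`. -/
theorem eps_approx_of_boxes (d : ℕ) (hd : 1 ≤ d) :
    ∃ C : ℝ, ∃ c : ℕ, ∀ X : Finset (Fin d → ℝ), X.Nonempty →
      ∀ ε : ℝ, 0 < ε → ε < 1 / 2 →
        ∃ P : Finset (Fin d → ℝ),
          (P.card : ℝ) ≤ C * (1 / ε) * (Real.log (1 / ε)) ^ (2 * d) *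
              (Real.log (2 + Real.log (1 / ε))) ^ c ∧
          IsEpsApprox (Rfam d) ε X P := by
  obtain ⟨K, hK, hsum⟩ := exists_sum_boxDisc_le d
  obtain ⟨A, hA⟩ := exists_two_pow_le K hK (2 * d)
  refine ⟨A, 0, fun X hX ε hε hε2 => ?_⟩
  obtain ⟨m, hm, hmA⟩ := hA ε hε hε2
  have hnonneg : ∀ t : ℕ, 0 ≤ 8 * boxDisc d (m + t + 2) / 2 ^ (m + t + 1) := by
    intro t
    unfold boxDisc
    positivity
  have hterm : ∀ t : ℕ, 8 * boxDisc d (m + t + 2) ≤ 2 ^ (m + t + 1) := by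
    intro t
    have h1 : 8 * boxDisc d (m + t + 2) / 2 ^ (m + t + 1) ≤ ε :=
      (Finset.single_le_sum (fun s _ => hnonneg s) (Finset.self_mem_range_succ t)).trans
        ((hsum m (t + 1)).trans hm)
    rw [← div_le_one (by positivity)]
    linarith
  have hcard : X.card ≤ 2 ^ (m + X.card) :=
    Nat.lt_two_pow_self.le.trans (Nat.pow_le_pow_right (by norm_num) (by omega))
  obtain ⟨P, hP, hPX, hP0, happ⟩ := exists_approx_card_le d m hterm X.card X hX hcard
  refine ⟨P, ?_, hPX, hP0, fun R hR => (happ R hR).trans ((hsum m _).trans hm)⟩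
  rw [pow_zero, mul_one]
  exact le_trans (by exact_mod_cast hP) hmA
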